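/- Let T > 0, let X_cstr, X_init, X_goal ⊆ ℝⁿ, and let F : ℝⁿ × [0,∞) → ℝⁿ be a continuous semiflow. Assume: (safety) F(x,t) ∈ X_cstr for all x ∈ X_init and all t ∈ [0,T]; (finite-time reachability) F(x,T) ∈ X_goal for all x ∈ X_init; (goal contractibility) X_goal is contractible within X_cstr. Define the reachable tuple R = { (F(x,t), t) : x ∈ X_init, t ∈ [0,T] } ⊆ ℝⁿ × [0,T] and the augmented constrained set X̃_cstr = X_cstr × [0,T]. Then R is contractible within X̃_cstr: for every continuous loop ℓ : [0,1] → ℝⁿ × [0,T] with ℓ(0) = ℓ(1) and image contained in R, there exist a point c̃ ∈ X̃_cstr and a continuous map H : [0,1] × [0,1] → X̃_cstr with H(s,0) = ℓ(s) and H(s,1) = c̃ for all s ∈ [0,1]. -/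

import Mathlib

/-- A loop in a set `Y`: a continuous map `ℓ : [0,1] → Y` with `ℓ 0 = ℓ 1`
(modelled as a map `ℝ → E` restricted to `[0,1]`). -/
def IsLoopIn {E : Type*} [TopologicalSpace E] (ℓ : ℝ → E) (Y : Set E) : Prop :=
  ContinuousOn ℓ (Set.Icc 0 1) ∧ ℓ 0 = ℓ 1 ∧ ∀ s ∈ Set.Icc (0 : ℝ) 1, ℓ s ∈ Y

/-- A loop `ℓ` is freely nullhomotopic within `X`: there are a point `c ∈ X` and a
continuous map `H : [0,1] × [0,1] → X` with `H (s,0) = ℓ s` and `H (s,1) = c`. -/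
def FreelyNullhomotopicIn {E : Type*} [TopologicalSpace E] (ℓ : ℝ → E) (X : Set E) : Prop :=
  ∃ c ∈ X, ∃ H : ℝ → ℝ → E,
    ContinuousOn (fun p : ℝ × ℝ => H p.1 p.2) (Set.Icc 0 1 ×ˢ Set.Icc 0 1) ∧
    (∀ s ∈ Set.Icc (0 : ℝ) 1, ∀ t ∈ Set.Icc (0 : ℝ) 1, H s t ∈ X) ∧
    (∀ s ∈ Set.Icc (0 : ℝ) 1, H s 0 = ℓ s) ∧
    (∀ s ∈ Set.Icc (0 : ℝ) 1, H s 1 = c)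

/-- `Y` is contractible within `X`: every loop with image in `Y` is freely
nullhomotopic within `X`. -/
def ContractibleWithin {E : Type*} [TopologicalSpace E] (Y X : Set E) : Prop :=
  ∀ ℓ : ℝ → E, IsLoopIn ℓ Y → FreelyNullhomotopicIn ℓ X

/-- A map on `[0,1]` that deforms within `X` to a freely nullhomotopic one is itself freely
nullhomotopic within `X`. -/
theorem FreelyNullhomotopicIn.of_homotopy {E : Type*} [TopologicalSpace E] {X : Set E}
    {ℓ γ : ℝ → E} {G : ℝ → ℝ → E} (hγ : FreelyNullhomotopicIn γ X)
    (hG : ContinuousOn (fun p : ℝ × ℝ => G p.1 p.2) (Set.Icc 0 1 ×ˢ Set.Icc 0 1))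
    (hGX : ∀ s ∈ Set.Icc (0 : ℝ) 1, ∀ t ∈ Set.Icc (0 : ℝ) 1, G s t ∈ X)
    (hG0 : ∀ s ∈ Set.Icc (0 : ℝ) 1, G s 0 = ℓ s)
    (hG1 : ∀ s ∈ Set.Icc (0 : ℝ) 1, G s 1 = γ s) :
    FreelyNullhomotopicIn ℓ X := by
  obtain ⟨c, hc, K, hK, hKX, hK0, hK1⟩ := hγ
  refine ⟨c, hc, fun s t => if t ≤ 1 / 2 then G s (2 * t) else K s (2 * t - 1), ?_, ?_, ?_, ?_⟩
  · have hsplit : (Set.Icc 0 1 ×ˢ Set.Icc 0 1 : Set (ℝ × ℝ)) =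
        Set.Icc 0 1 ×ˢ Set.Icc 0 (1 / 2) ∪ Set.Icc 0 1 ×ˢ Set.Icc (1 / 2) 1 := by
      rw [← Set.prod_union, Set.Icc_union_Icc_eq_Icc (by norm_num) (by norm_num)]
    rw [hsplit]
    refine ContinuousOn.union_of_isClosed ?_ ?_ (isClosed_Icc.prod isClosed_Icc)
      (isClosed_Icc.prod isClosed_Icc)
    · have h : ContinuousOn (fun p : ℝ × ℝ => G p.1 (2 * p.2))
          (Set.Icc 0 1 ×ˢ Set.Icc 0 (1 / 2)) :=
        hG.comp (f := fun p : ℝ × ℝ => (p.1, 2 * p.2)) (by fun_prop) fun p hp =>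
          ⟨hp.1, by linarith [hp.2.1], by linarith [hp.2.2]⟩
      exact h.congr fun p hp => if_pos hp.2.2
    · have h : ContinuousOn (fun p : ℝ × ℝ => K p.1 (2 * p.2 - 1))
          (Set.Icc 0 1 ×ˢ Set.Icc (1 / 2) 1) :=
        hK.comp (f := fun p : ℝ × ℝ => (p.1, 2 * p.2 - 1)) (by fun_prop) fun p hp =>
          ⟨hp.1, by linarith [hp.2.1], by linarith [hp.2.2]⟩
      refine h.congr fun p hp => ?_
      rcases hp.2.1.eq_or_lt with heq | hlt
      · simp [← heq, hG1 p.1 hp.1, hK0 p.1 hp.1]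
      · exact if_neg hlt.not_ge
  · intro s hs t ht
    dsimp only
    split_ifs with h
    · exact hGX s hs _ ⟨by linarith [ht.1], by linarith⟩
    · exact hKX s hs _ ⟨by linarith, by linarith [ht.2]⟩
  · intro s hs
    simp [hG0 s hs]
  · intro s hs
    norm_num [hK1 s hs]

theorem FreelyNullhomotopicIn.prodMk_const {E E' : Type*} [TopologicalSpace E]
    [TopologicalSpace E'] {X : Set E} {X' : Set E'} {ℓ : ℝ → E} {b : E'}
    (h : FreelyNullhomotopicIn ℓ X) (hb : b ∈ X') :
    FreelyNullhomotopicIn (fun s => (ℓ s, b)) (X ×ˢ X') := by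
  obtain ⟨c, hc, H, hH, hHX, hH0, hH1⟩ := h
  exact ⟨(c, b), ⟨hc, hb⟩, fun s t => (H s t, b), hH.prodMk continuousOn_const,
    fun s hs t ht => ⟨hHX s hs t ht, hb⟩, fun s hs => by simp only [hH0 s hs],
    fun s hs => by simp only [hH1 s hs]⟩

/-- Lemma 2 of the paper, contractibility of the reachable tuple:
for a continuous semiflow `F` satisfying safety, finite-time reachability and goal-set
contractibility, the reachable tuple `R = {(F (x,t), t) : x ∈ X_init, t ∈ [0,T]}` is
contractible within the augmented constrained set `X_cstr × [0,T]`. -/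
theorem reachable_tuple_contractible {n : ℕ}
    (T : ℝ) (hT : 0 < T)
    (Xcstr Xinit Xgoal : Set (EuclideanSpace ℝ (Fin n)))
    (F : EuclideanSpace ℝ (Fin n) × ℝ → EuclideanSpace ℝ (Fin n))
    (hFcont : ContinuousOn F (Set.univ ×ˢ Set.Ici (0 : ℝ)))
    (hF0 : ∀ x : EuclideanSpace ℝ (Fin n), F (x, 0) = x)
    (hFadd : ∀ x : EuclideanSpace ℝ (Fin n), ∀ s t : ℝ, 0 ≤ s → 0 ≤ t →
      F (F (x, s), t) = F (x, s + t))
    (hsafe : ∀ x ∈ Xinit, ∀ t ∈ Set.Icc (0 : ℝ) T, F (x, t) ∈ Xcstr)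
    (hreach : ∀ x ∈ Xinit, F (x, T) ∈ Xgoal)
    (hgoal : ContractibleWithin Xgoal Xcstr) :
    ContractibleWithin
      {p : EuclideanSpace ℝ (Fin n) × ℝ | ∃ x ∈ Xinit, ∃ t ∈ Set.Icc (0 : ℝ) T, p = (F (x, t), t)}
      (Xcstr ×ˢ Set.Icc (0 : ℝ) T) := by
  rintro ℓ ⟨hℓ, hℓ01, hℓR⟩
  have hflow : ∀ s ∈ Set.Icc (0 : ℝ) 1, ∃ x ∈ Xinit, (ℓ s).2 ∈ Set.Icc 0 T ∧
      ∀ r, 0 ≤ r → F ((ℓ s).1, r) = F (x, (ℓ s).2 + r) := by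
    intro s hs
    obtain ⟨x, hx, t, ht, hp⟩ := hℓR s hs
    exact ⟨x, hx, by simpa [hp] using ht, fun r hr => by rw [hp]; exact hFadd x t r ht.1 hr⟩
  have hG : ContinuousOn (fun p : ℝ × ℝ => (F ((ℓ p.1).1, p.2 * (T - (ℓ p.1).2)),
      (ℓ p.1).2 + p.2 * (T - (ℓ p.1).2))) (Set.Icc 0 1 ×ˢ Set.Icc 0 1) := by
    have hℓ' : ContinuousOn (fun p : ℝ × ℝ => ℓ p.1) (Set.Icc 0 1 ×ˢ Set.Icc 0 1) :=
      hℓ.comp continuousOn_fst fun p hp => hp.1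
    have hr : ContinuousOn (fun p : ℝ × ℝ => p.2 * (T - (ℓ p.1).2))
        (Set.Icc 0 1 ×ˢ Set.Icc 0 1) := continuousOn_snd.mul (continuousOn_const.sub hℓ'.snd)
    refine (hFcont.comp (hℓ'.fst.prodMk hr) ?_).prodMk (hℓ'.snd.add hr)
    intro p hp
    obtain ⟨-, -, ht, -⟩ := hflow p.1 hp.1
    exact ⟨Set.mem_univ _, mul_nonneg hp.2.1 (sub_nonneg.2 ht.2)⟩
  have hγ : IsLoopIn (fun s => F ((ℓ s).1, T - (ℓ s).2)) Xgoal := by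
    refine ⟨?_, by simp only [hℓ01], fun s hs => ?_⟩
    · have h := hG.fst.comp (f := fun s : ℝ => (s, (1 : ℝ))) (s := Set.Icc 0 1) (by fun_prop)
        fun s hs => ⟨hs, zero_le_one, le_rfl⟩
      simpa [Function.comp_def] using h
    · obtain ⟨x, hx, ht, hadd⟩ := hflow s hs
      simpa [hadd _ (sub_nonneg.2 ht.2)] using hreach x hx
  refine FreelyNullhomotopicIn.of_homotopy
    (G := fun s u => (F ((ℓ s).1, u * (T - (ℓ s).2)), (ℓ s).2 + u * (T - (ℓ s).2)))
    ((hgoal _ hγ).prodMk_const ⟨hT.le, le_rfl⟩) hG ?_ ?_ ?_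
  · intro s hs u hu
    obtain ⟨x, hx, ht, hadd⟩ := hflow s hs
    have h0 : 0 ≤ u * (T - (ℓ s).2) := mul_nonneg hu.1 (sub_nonneg.2 ht.2)
    have h1 : u * (T - (ℓ s).2) ≤ T - (ℓ s).2 :=
      mul_le_of_le_one_left (sub_nonneg.2 ht.2) hu.2
    have hmem : (ℓ s).2 + u * (T - (ℓ s).2) ∈ Set.Icc 0 T :=
      ⟨add_nonneg ht.1 h0, by linarith⟩
    refine ⟨?_, hmem⟩
    simpa only [hadd _ h0] using hsafe x hx _ hmem
  · intro s _
    simp [hF0]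
  · intro s _
    simp
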